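/- Fix an integer m ≥ 2. Define Φ_m : ℝ → ℝ^{2m+2} by Φ_m(t) = (cos t, sin t, cos 3t, sin 3t, cos 9t, sin 9t, …, cos(3^m t), sin(3^m t)), and let A_m = { π·ℓ/(3^m − 1) : ℓ = 0, 1, …, 2(3^m − 1) − 1 } be a set of 2(3^m − 1) equally spaced points. Then the polytope P_m = conv(Φ_m(A_m)) ⊂ ℝ^{2m+2} satisfies: P_m = −P_m; the affine hull of P_m is all of ℝ^{2m+2} (so P_m is a polytope of dimension 2(m+1)); the vertices of P_m are exactly the 2(3^m − 1) points Φ_m(t) for t ∈ A_m; and P_m is 2-neighborly, i.e., for every two vertices u, w of P_m with w ≠ −u, the closed segment [u, w] is a face of P_m. -/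

import Mathlib

open Set

/-- A polytope: the convex hull of a finite set of points. -/
def IsPolytope {E : Type*} [AddCommGroup E] [Module ℝ E] (P : Set E) : Prop :=
  ∃ V : Finset E, P = convexHull ℝ (V : Set E)

/-- A (nonempty, proper) exposed face of `P`. -/
def IsProperFace {E : Type*} [AddCommGroup E] [Module ℝ E] [TopologicalSpace E]
    (P F : Set E) : Prop :=
  F.Nonempty ∧ F ≠ P ∧ IsExposed ℝ P F

/-- The curve `Φ_m(t) = (cos t, sin t, cos 3t, sin 3t, …, cos (3^m t), sin (3^m t)) ∈ ℝ^{2(m+1)}`: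
coordinate `2i` is `cos (3^i t)` and coordinate `2i+1` is `sin (3^i t)` for `0 ≤ i ≤ m`. -/
noncomputable def Phi (m : ℕ) (t : ℝ) : Fin (2 * (m + 1)) → ℝ := fun j =>
  if j.val % 2 = 0 then Real.cos ((3 : ℝ) ^ (j.val / 2) * t)
  else Real.sin ((3 : ℝ) ^ (j.val / 2) * t)

/-- The set `A_m` of `2(3^m - 1)` equally spaced points `π ℓ / (3^m - 1)`,
`ℓ = 0, 1, …, 2(3^m - 1) - 1`, on `[0, 2π)`. -/
noncomputable def Apts (m : ℕ) : Finset ℝ :=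
  (Finset.range (2 * (3 ^ m - 1))).image fun ℓ : ℕ => Real.pi * ℓ / ((3 : ℝ) ^ m - 1)

/-- The functional whose value at `Phi m t` is `cos (3 ^ i * t - μ)`. -/
noncomputable def cosFunctional (m i : ℕ) (hi : i ≤ m) (μ : ℝ) :
    (Fin (2 * (m + 1)) → ℝ) →L[ℝ] ℝ :=
  Real.cos μ • ContinuousLinearMap.proj (R := ℝ) (φ := fun _ => ℝ) ⟨2 * i, by omega⟩ +
    Real.sin μ • ContinuousLinearMap.proj (R := ℝ) (φ := fun _ => ℝ) ⟨2 * i + 1, by omega⟩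

lemma cosFunctional_Phi (m i : ℕ) (hi : i ≤ m) (μ t : ℝ) :
    cosFunctional m i hi μ (Phi m t) = Real.cos ((3 : ℝ) ^ i * t - μ) := by
  have h1 : (2 * i + 1) / 2 = i := by omega
  have h2 : (2 * i + 1) % 2 = 1 := by omega
  simp [cosFunctional, Phi, Real.cos_sub, h1, h2]
  ring

/-- The angle `π ℓ / (3 ^ m - 1)`, for an arbitrary integer `ℓ`. -/
noncomputable def angle (m : ℕ) (l : ℤ) : ℝ := Real.pi * l / ((3 : ℝ) ^ m - 1)

lemma three_pow_sub_one_pos {m : ℕ} (hm : 2 ≤ m) : (0 : ℝ) < (3 : ℝ) ^ m - 1 := by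
  have : (1 : ℝ) < 3 ^ m := one_lt_pow₀ (by norm_num) (by omega)
  linarith

lemma int_three_pow_ge {m : ℕ} (hm : 2 ≤ m) : (9 : ℤ) ≤ 3 ^ m := by
  calc (9 : ℤ) = 3 ^ 2 := by norm_num
    _ ≤ 3 ^ m := pow_le_pow_right₀ (by norm_num) hm

lemma Phi_add_int_mul_two_pi (m : ℕ) (t : ℝ) (n : ℤ) :
    Phi m (t + n * (2 * Real.pi)) = Phi m t := by
  funext j
  have h : (3 : ℝ) ^ (j.val / 2) * (t + n * (2 * Real.pi)) =
      3 ^ (j.val / 2) * t + ((3 ^ (j.val / 2) * n : ℤ) : ℝ) * (2 * Real.pi) := by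
    push_cast; ring
  simp only [Phi, h, Real.cos_add_int_mul_two_pi, Real.sin_add_int_mul_two_pi]

lemma Phi_add_pi (m : ℕ) (t : ℝ) : Phi m (t + Real.pi) = -Phi m t := by
  funext j
  obtain ⟨k, hk⟩ : Odd (3 ^ (j.val / 2)) := Odd.pow (by decide)
  have hk' : (3 : ℝ) ^ (j.val / 2) = 2 * k + 1 := by exact_mod_cast hk
  have h : (3 : ℝ) ^ (j.val / 2) * (t + Real.pi) =
      3 ^ (j.val / 2) * t + Real.pi + (k : ℕ) * (2 * Real.pi) := by
    rw [hk']; ring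
  simp only [Phi, Pi.neg_apply, h, Real.cos_add_nat_mul_two_pi, Real.sin_add_nat_mul_two_pi,
    Real.cos_add_pi, Real.sin_add_pi]
  split_ifs <;> rfl

lemma angle_mul_eq_iff {m : ℕ} (hm : 2 ≤ m) (i : ℕ) (a b n : ℤ) :
    (3 : ℝ) ^ i * angle m a = 3 ^ i * angle m b + n * (2 * Real.pi) ↔
      3 ^ i * a = 3 ^ i * b + n * (2 * (3 ^ m - 1)) := by
  have hq := three_pow_sub_one_pos hm
  have hpi := Real.pi_pos
  have h : (3 : ℝ) ^ i * angle m a - (3 ^ i * angle m b + n * (2 * Real.pi)) =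
      Real.pi / ((3 : ℝ) ^ m - 1) *
        ((3 ^ i * a - (3 ^ i * b + n * (2 * (3 ^ m - 1))) : ℤ) : ℝ) := by
    unfold angle; push_cast; field_simp
  rw [← sub_eq_zero, h, mul_eq_zero, or_iff_right (by positivity), Int.cast_eq_zero, sub_eq_zero]

lemma dvd_of_dvd_three_pow_mul {m : ℕ} (hm : 2 ≤ m) (i : ℕ) {d : ℤ}
    (h : (2 * (3 ^ m - 1) : ℤ) ∣ 3 ^ i * d) : (2 * (3 ^ m - 1) : ℤ) ∣ d := by
  refine IsCoprime.dvd_of_dvd_mul_left (IsCoprime.pow_right ?_) h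
  obtain ⟨k, rfl⟩ : ∃ k, m = k + 1 := ⟨m - 1, by omega⟩
  exact ⟨1, 1 - 2 * 3 ^ k, by ring⟩

lemma Phi_angle_eq_iff {m : ℕ} (hm : 2 ≤ m) (a b : ℤ) :
    Phi m (angle m a) = Phi m (angle m b) ↔ (2 * (3 ^ m - 1) : ℤ) ∣ a - b := by
  constructor
  · intro h
    have h1 := congrArg (cosFunctional m 0 (by omega) (angle m b)) h
    rw [cosFunctional_Phi, cosFunctional_Phi] at h1
    simp only [pow_zero, one_mul, sub_self, Real.cos_zero] at h1
    obtain ⟨n, hn⟩ := (Real.cos_eq_one_iff _).1 h1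
    have := (angle_mul_eq_iff hm 0 a b n).1 (by simp only [pow_zero, one_mul]; linarith)
    exact ⟨n, by simp only [pow_zero, one_mul] at this; linarith⟩
  · rintro ⟨n, hn⟩
    have := (angle_mul_eq_iff hm 0 a b n).2 (by simp only [pow_zero, one_mul]; linarith)
    simp only [pow_zero, one_mul] at this
    rw [this, Phi_add_int_mul_two_pi]

lemma neg_Phi_angle {m : ℕ} (hm : 2 ≤ m) (a : ℤ) :
    -Phi m (angle m a) = Phi m (angle m (a + (3 ^ m - 1))) := by
  have hq := three_pow_sub_one_pos hm
  rw [← Phi_add_pi]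
  congr 1
  unfold angle; push_cast; field_simp

lemma Phi_image_Apts_eq_image_range (m : ℕ) :
    Phi m '' ↑(Apts m) =
      (fun l : ℕ => Phi m (angle m l)) '' (Finset.range (2 * (3 ^ m - 1)) : Set ℕ) := by
  rw [Apts, Finset.coe_image, image_image]
  simp [angle]

lemma cast_two_mul_three_pow_sub_one (m : ℕ) :
    ((2 * (3 ^ m - 1) : ℕ) : ℤ) = 2 * (3 ^ m - 1) := by
  push_cast [Nat.one_le_pow]; ring

lemma Phi_image_Apts {m : ℕ} (hm : 2 ≤ m) :
    Phi m '' ↑(Apts m) = range fun l : ℤ => Phi m (angle m l) := by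
  have h9 := int_three_pow_ge hm
  have hN := cast_two_mul_three_pow_sub_one m
  rw [Phi_image_Apts_eq_image_range]
  apply Subset.antisymm
  · rintro _ ⟨l, -, rfl⟩
    exact ⟨l, rfl⟩
  · rintro _ ⟨l, rfl⟩
    have h0 : 0 ≤ l % (2 * (3 ^ m - 1)) := Int.emod_nonneg _ (by omega)
    have h1 : l % (2 * (3 ^ m - 1)) < 2 * (3 ^ m - 1) := Int.emod_lt_of_pos _ (by omega)
    refine ⟨(l % (2 * (3 ^ m - 1))).toNat, ?_, ?_⟩
    · simp only [Finset.coe_range, mem_Iio]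
      omega
    · simp only [Int.toNat_of_nonneg h0]
      rw [Phi_angle_eq_iff hm]
      exact (Int.mod_modEq l _).symm.dvd

lemma ncard_Phi_image_Apts {m : ℕ} (hm : 2 ≤ m) :
    (Phi m '' ↑(Apts m)).ncard = 2 * (3 ^ m - 1) := by
  rw [Phi_image_Apts_eq_image_range, InjOn.ncard_image, ncard_coe_finset, Finset.card_range]
  intro a ha b hb hab
  simp only [Finset.coe_range, mem_Iio] at ha hb
  have hN := cast_two_mul_three_pow_sub_one m
  have h := Int.eq_zero_of_abs_lt_dvd ((Phi_angle_eq_iff hm _ _).1 hab) (by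
    rw [abs_lt]; constructor <;> omega)
  omega

/-- If a linear functional attains its maximum over `S` exactly on the nonempty subset `T`, then
`convexHull T` is an exposed face of `convexHull S`. -/
lemma isExposed_convexHull {E : Type*} [AddCommGroup E] [Module ℝ E] [TopologicalSpace E]
    {S T : Set E} (hTS : T ⊆ S) (hT : T.Nonempty) (l : E →L[ℝ] ℝ) (M : ℝ)
    (hle : ∀ x ∈ S, l x ≤ M) (heq : ∀ x ∈ S, l x = M ↔ x ∈ T) :
    IsExposed ℝ (convexHull ℝ S) (convexHull ℝ T) := by
  intro _
  have hTM : ∀ x ∈ convexHull ℝ T, l x = M := by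
    have hc : Convex ℝ {x | l x = M} := convex_hyperplane l.toLinearMap.isLinear M
    exact fun x hx => convexHull_min (fun y hy => (heq y (hTS hy)).2 hy) hc hx
  have hSM : ∀ x ∈ convexHull ℝ S, l x ≤ M := by
    have hc : Convex ℝ {x | l x ≤ M} := convex_halfSpace_le l.toLinearMap.isLinear M
    exact fun x hx => convexHull_min hle hc hx
  have hconv : Convex ℝ ({x | l x < M} ∪ convexHull ℝ T) := by
    rw [convex_iff_forall_pos]
    rintro x hx y hy a b ha hb hab
    have key : l (a • x + b • y) = a * l x + b * l y := by simp
    have hxM : l x ≤ M := hx.elim (fun h => le_of_lt h) fun h => (hTM x h).le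
    have hyM : l y ≤ M := hy.elim (fun h => le_of_lt h) fun h => (hTM y h).le
    have hM : a * M + b * M = M := by rw [← add_mul, hab, one_mul]
    rcases hx with hx | hx
    · left
      simp only [mem_ofPred_eq] at hx ⊢
      nlinarith [mul_lt_mul_of_pos_left hx ha, mul_le_mul_of_nonneg_left hyM hb.le]
    rcases hy with hy | hy
    · left
      simp only [mem_ofPred_eq] at hy ⊢
      nlinarith [mul_lt_mul_of_pos_left hy hb, mul_le_mul_of_nonneg_left hxM ha.le]
    · exact Or.inr (convex_convexHull ℝ T hx hy ha.le hb.le hab)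
  refine ⟨l, Subset.antisymm ?_ ?_⟩
  · intro x hx
    exact ⟨convexHull_mono hTS hx, fun y hy => (hTM x hx).symm ▸ hSM y hy⟩
  · rintro x ⟨hxS, hx⟩
    obtain ⟨t, ht⟩ := hT
    have hx' : M ≤ l x :=
      (heq t (hTS ht)).2 ht ▸ hx t (subset_convexHull ℝ S (hTS ht))
    have hmem := convexHull_min (t := {x | l x < M} ∪ convexHull ℝ T) (fun y hy => ?_) hconv hxS
    · exact hmem.resolve_left fun h => absurd h (not_lt.2 hx')
    · rcases (hle y hy).lt_or_eq with h | h
      · exact Or.inl h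
      · exact Or.inr (subset_convexHull ℝ T ((heq y hy).1 h))

lemma extremePoints_convexHull_Phi {m : ℕ} (hm : 2 ≤ m) :
    (convexHull ℝ (Phi m '' ↑(Apts m))).extremePoints ℝ = Phi m '' ↑(Apts m) := by
  refine Subset.antisymm extremePoints_convexHull_subset ?_
  rw [Phi_image_Apts hm]
  rintro _ ⟨a, rfl⟩
  rw [← isExtreme_singleton, ← convexHull_singleton (𝕜 := ℝ)]
  refine (isExposed_convexHull (singleton_subset_iff.2 (mem_range_self a)) (singleton_nonempty _)
    (cosFunctional m 0 (by omega) (angle m a)) 1 ?_ ?_).isExtreme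
  · rintro _ ⟨b, rfl⟩
    simp only [cosFunctional_Phi]
    exact Real.cos_le_one _
  · rintro _ ⟨b, rfl⟩
    simp only [cosFunctional_Phi, mem_singleton_iff, pow_zero, one_mul]
    constructor
    · intro h
      obtain ⟨n, hn⟩ := (Real.cos_eq_one_iff _).1 h
      rw [show angle m b = angle m a + n * (2 * Real.pi) by linarith, Phi_add_int_mul_two_pi]
    · intro h
      have h1 := congrArg (cosFunctional m 0 (by omega) (angle m a)) h
      simpa [cosFunctional_Phi] using h1

/-- Some power `3 ^ i`, `i < m`, moves `d` to within a third of the circle `ℤ / 2 (3 ^ m - 1)`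
from the origin, unless `d` is the antipode of the origin. -/
lemma exists_three_pow_mul_near_zero {m : ℕ} (hm : 2 ≤ m) (d : ℤ)
    (hd : ¬ (2 * (3 ^ m - 1) : ℤ) ∣ d - (3 ^ m - 1)) :
    ∃ i < m, ∃ k : ℤ, 3 * |3 ^ i * d - k * (2 * (3 ^ m - 1))| < 2 * (3 ^ m - 1) := by
  have h9 := int_three_pow_ge hm
  obtain ⟨q, hq⟩ : ∃ q : ℤ, q = 3 ^ m - 1 := ⟨_, rfl⟩
  rw [← hq] at hd ⊢
  obtain ⟨e, n, he, hen⟩ : ∃ e n : ℤ, |e| ≤ q ∧ d - q = e + n * (2 * q) := by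
    refine ⟨d % (2 * q) - q, d / (2 * q), ?_, ?_⟩
    · have h0 : 0 ≤ d % (2 * q) := Int.emod_nonneg _ (by omega)
      have h1 : d % (2 * q) < 2 * q := Int.emod_lt_of_pos _ (by omega)
      rw [abs_le]; constructor <;> omega
    · have := Int.emod_add_mul_ediv d (2 * q)
      linarith
  have he0 : e ≠ 0 := by
    rintro rfl
    exact hd ⟨n, by linarith⟩
  have hex : ∃ i, q < 3 ^ (i + 1) * |e| := by
    refine ⟨m - 1, ?_⟩
    rw [Nat.sub_add_cancel (by omega)]
    nlinarith [Int.one_le_abs he0]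
  classical
  have hspec := Nat.find_spec hex
  have hmin : ∀ j < Nat.find hex, ¬ q < 3 ^ (j + 1) * |e| := fun j hj => Nat.find_min hex hj
  have hlt : Nat.find hex < m := by
    refine lt_of_le_of_lt (Nat.find_min' hex (m := m - 1) ?_) (by omega)
    rw [Nat.sub_add_cancel (by omega)]
    nlinarith [Int.one_le_abs he0]
  generalize Nat.find hex = i at hspec hmin hlt
  have hle : 3 ^ i * |e| ≤ q := by
    rcases i with _ | j
    · simpa using he
    · exact not_lt.1 (hmin j (by omega))
  obtain ⟨r, hr⟩ : Odd ((3 : ℤ) ^ i) := Odd.pow (by decide)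
  have habs : |3 ^ i * e| = 3 ^ i * |e| := by rw [abs_mul, abs_of_pos (by positivity)]
  have hspec' : q < 3 * |3 ^ i * e| := by rw [habs]; rw [pow_succ] at hspec; linarith
  rw [← habs] at hle
  have hd' : 3 ^ i * d = 3 ^ i * e + q + (r + 3 ^ i * n) * (2 * q) := by
    have : d = e + q + n * (2 * q) := by linarith
    rw [this]; linear_combination q * hr
  refine ⟨i, hlt, ?_⟩
  rcases le_total 0 (3 ^ i * e) with h | h
  · refine ⟨r + 3 ^ i * n + 1, ?_⟩
    rw [show 3 ^ i * d - (r + 3 ^ i * n + 1) * (2 * q) = 3 ^ i * e - q by rw [hd']; ring]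
    rw [abs_of_nonneg h] at hle hspec'
    rw [abs_of_nonpos (by linarith)]
    linarith
  · refine ⟨r + 3 ^ i * n, ?_⟩
    rw [show 3 ^ i * d - (r + 3 ^ i * n) * (2 * q) = 3 ^ i * e + q by rw [hd']; ring]
    rw [abs_of_nonpos h] at hle hspec'
    rw [abs_of_nonneg (by linarith)]
    linarith

lemma isExposed_segment_Phi {m : ℕ} (hm : 2 ≤ m) (a b : ℤ)
    (hab : Phi m (angle m b) ≠ -Phi m (angle m a)) :
    IsExposed ℝ (convexHull ℝ (Phi m '' ↑(Apts m)))
      (segment ℝ (Phi m (angle m a)) (Phi m (angle m b))) := by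
  have hq := three_pow_sub_one_pos hm
  have hpi := Real.pi_pos
  rw [neg_Phi_angle hm, ne_eq, Phi_angle_eq_iff hm, ← sub_sub] at hab
  obtain ⟨i, hi, k, hk⟩ := exists_three_pow_mul_near_zero hm (b - a) hab
  obtain ⟨α, hα⟩ : ∃ α, α = (3 : ℝ) ^ i * angle m a := ⟨_, rfl⟩
  obtain ⟨β, hβ⟩ : ∃ β, β = (3 : ℝ) ^ i * angle m b - k * (2 * Real.pi) := ⟨_, rfl⟩
  obtain ⟨μ, hμ⟩ : ∃ μ, μ = (α + β) / 2 := ⟨_, rfl⟩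
  have hαβ : |β - α| < 2 * Real.pi / 3 := by
    have h : β - α = Real.pi / ((3 : ℝ) ^ m - 1) *
        ((3 ^ i * (b - a) - k * (2 * (3 ^ m - 1)) : ℤ) : ℝ) := by
      rw [hα, hβ]; unfold angle; push_cast; field_simp; ring
    have hk' : 3 * |((3 ^ i * (b - a) - k * (2 * (3 ^ m - 1)) : ℤ) : ℝ)| < 2 * (3 ^ m - 1) := by
      exact_mod_cast hk
    rw [h, abs_mul, abs_of_pos (by positivity)]
    calc _ < Real.pi / ((3 : ℝ) ^ m - 1) * (2 * (3 ^ m - 1) / 3) :=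
          mul_lt_mul_of_pos_left (by linarith) (by positivity)
      _ = _ := by field_simp
  obtain ⟨c, hc⟩ : ∃ c, c = Real.cos ((β - α) / 2) := ⟨_, rfl⟩
  have hc2 : 1 / 2 < c := by
    rw [hc, ← Real.cos_abs, ← Real.cos_pi_div_three]
    have h2 : |(β - α) / 2| = |β - α| / 2 := by rw [abs_div, abs_two]
    exact Real.cos_lt_cos_of_nonneg_of_le_pi_div_two (abs_nonneg _) (by linarith) (by linarith)
  let l : (Fin (2 * (m + 1)) → ℝ) →L[ℝ] ℝ :=
    (3 * c ^ 2 - 3 / 4) • cosFunctional m i hi.le μ -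
      (1 / 4 : ℝ) • cosFunctional m (i + 1) hi (3 * μ)
  have hl : ∀ t, l (Phi m t) =
      2 * c ^ 3 - (Real.cos (3 ^ i * t - μ) - c) ^ 2 * (Real.cos (3 ^ i * t - μ) + 2 * c) := by
    intro t
    have h3 : (3 : ℝ) ^ (i + 1) * t - 3 * μ = 3 * (3 ^ i * t - μ) := by ring
    simp only [l, sub_apply, smul_apply, smul_eq_mul,
      cosFunctional_Phi, h3, Real.cos_three_mul]
    ring
  have hmax : ∀ t, Real.cos (3 ^ i * t - μ) = c ↔ l (Phi m t) = 2 * c ^ 3 := by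
    intro t
    have h1 := Real.neg_one_le_cos (3 ^ i * t - μ)
    rw [hl, sub_eq_self, mul_eq_zero, or_iff_left (by linarith), sq_eq_zero_iff, sub_eq_zero]
  rw [Phi_image_Apts hm, ← convexHull_pair]
  refine isExposed_convexHull ?_ (insert_nonempty _ _) l (2 * c ^ 3) ?_ ?_
  · rintro _ (rfl | rfl)
    exacts [⟨a, rfl⟩, ⟨b, rfl⟩]
  · rintro _ ⟨x, rfl⟩
    have h1 := Real.neg_one_le_cos (3 ^ i * angle m x - μ)
    simp only [hl]
    nlinarith [mul_nonneg (sq_nonneg (Real.cos (3 ^ i * angle m x - μ) - c))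
      (by linarith : (0 : ℝ) ≤ Real.cos (3 ^ i * angle m x - μ) + 2 * c)]
  · rintro _ ⟨x, rfl⟩
    constructor
    · intro h
      replace h := (hmax _).2 h
      rw [hc, Real.cos_eq_cos_iff] at h
      obtain ⟨n, h | h⟩ := h
      · right
        have := (angle_mul_eq_iff hm i x b (-k - n)).1 (by push_cast; linarith)
        exact (Phi_angle_eq_iff hm _ _).2
          (dvd_of_dvd_three_pow_mul hm i ⟨-k - n, by linarith⟩)
      · left
        have := (angle_mul_eq_iff hm i x a n).1 (by linarith)
        exact (Phi_angle_eq_iff hm _ _).2 (dvd_of_dvd_three_pow_mul hm i ⟨n, by linarith⟩)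
    · rintro (h | h)
      · dsimp only at h ⊢
        rw [h, ← hmax, hc, ← Real.cos_neg]
        congr 1; linarith
      · dsimp only at h ⊢
        rw [mem_singleton_iff.1 h, ← hmax, hc, ← Real.cos_add_int_mul_two_pi ((β - α) / 2) k]
        congr 1; linarith

open Polynomial in
/-- No nonzero linear functional vanishes at all points of `Phi m '' Apts m`. -/
lemma eq_zero_of_forall_sum_mul_Phi_eq_zero {m : ℕ} (hm : 2 ≤ m) (c : Fin (2 * (m + 1)) → ℝ)
    (hc : ∀ l : ℤ, ∑ j, c j * Phi m (angle m l) j = 0) : c = 0 := by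
  have hq := three_pow_sub_one_pos hm
  have h9 : 9 ≤ 3 ^ m := by exact_mod_cast int_three_pow_ge hm
  have hN := cast_two_mul_three_pow_sub_one m
  obtain ⟨N, hNdef⟩ : ∃ N, N = 2 * (3 ^ m - 1) := ⟨_, rfl⟩
  rw [← hNdef] at hN
  have hpow : ∀ j : Fin (2 * (m + 1)), 3 ^ (j.val / 2) ≤ 3 ^ m := fun j =>
    Nat.pow_le_pow_right (by norm_num) (by omega)
  -- `Phi m t j` is the real part of `ε j * exp (3 ^ (j / 2) * t * I)`
  let ε : Fin (2 * (m + 1)) → ℂ := fun j => if j.val % 2 = 0 then 1 else -Complex.I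
  let p : ℂ[X] := ∑ j, (C (c j * ε j) * X ^ (3 ^ (j.val / 2)) +
    C (c j * (starRingEnd ℂ) (ε j)) * X ^ (N - 3 ^ (j.val / 2)))
  let ζ : ℤ → ℂ := fun l => Complex.exp (angle m l * Complex.I)
  have hζ : ∀ (l : ℤ) (n : ℕ), ζ l ^ n = Complex.exp ((n * angle m l : ℝ) * Complex.I) := by
    intro l n
    rw [← Complex.exp_nat_mul]; push_cast; ring_nf
  have hζN : ∀ (l : ℤ) (n : ℕ), n ≤ N →
      ζ l ^ (N - n) = Complex.exp (-((n * angle m l : ℝ) * Complex.I)) := by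
    intro l n hn
    rw [hζ, Complex.exp_eq_exp_iff_exists_int]
    refine ⟨l, ?_⟩
    have hNR : (N : ℝ) = 2 * (3 ^ m - 1) := by exact_mod_cast hN
    have : (N : ℝ) * angle m l = l * (2 * Real.pi) := by
      rw [hNR]; unfold angle; field_simp
    have h' := congrArg (fun x : ℝ => (x : ℂ)) this
    push_cast [Nat.cast_sub hn] at h' ⊢
    linear_combination Complex.I * h'
  have hterm : ∀ (l : ℤ) (j : Fin (2 * (m + 1))),
      ε j * ζ l ^ (3 ^ (j.val / 2)) + (starRingEnd ℂ) (ε j) * ζ l ^ (N - 3 ^ (j.val / 2)) =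
        2 * (Phi m (angle m l) j : ℂ) := by
    intro l j
    have := hpow j
    rw [hζN l _ (by omega), hζ, ← neg_mul, Complex.exp_mul_I, Complex.exp_mul_I, Complex.cos_neg,
      Complex.sin_neg]
    simp only [ε, Phi]
    split_ifs
    · simp only [map_one]; push_cast; ring
    · simp only [map_neg, Complex.conj_I]
      push_cast
      ring_nf
      simp only [Complex.I_sq]
      ring
  have heval : ∀ l : ℤ, p.eval (ζ l) = 0 := by
    intro l
    have h := congrArg (fun x : ℝ => 2 * (x : ℂ)) (hc l)
    simp only [Complex.ofReal_sum, Complex.ofReal_mul, Finset.mul_sum, Complex.ofReal_zero,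
      mul_zero] at h
    rw [← h]
    simp only [p, eval_finsetSum, eval_add, eval_mul, eval_C, eval_pow, eval_X]
    refine Finset.sum_congr rfl fun j _ => ?_
    linear_combination (c j : ℂ) * hterm l j
  have hdeg : p.natDegree < N := by
    refine lt_of_le_of_lt (natDegree_sum_le_of_forall_le (n := N - 1) _ _ fun j _ => ?_) (by omega)
    have h1 : 1 ≤ 3 ^ (j.val / 2) := Nat.one_le_pow _ _ (by norm_num)
    have h2 := hpow j
    refine natDegree_add_le_of_degree_le ?_ ?_
    · exact (natDegree_C_mul_X_pow_le _ _).trans (by omega)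
    · exact (natDegree_C_mul_X_pow_le _ _).trans (by omega)
  have hp : p = 0 := by
    refine eq_zero_of_natDegree_lt_card_of_eval_eq_zero p
      (f := fun l : Fin N => ζ (l.val : ℤ)) ?_ (fun l => heval _) (by simpa using hdeg)
    intro a b hab
    obtain ⟨n, hn⟩ := Complex.exp_eq_exp_iff_exists_int.1 hab
    have h1 : angle m a.val = angle m b.val + n * (2 * Real.pi) := by
      have := congrArg Complex.im hn
      simpa using this
    have h2 := (angle_mul_eq_iff hm 0 _ _ n).1 (by simpa using h1)
    have h3 := Int.eq_zero_of_abs_lt_dvd (x := (a.val : ℤ) - b.val) (m := N)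
      ⟨n, by rw [hN]; simp only [pow_zero, one_mul] at h2; linarith⟩
      (by rw [abs_lt]; constructor <;> omega)
    exact Fin.ext (by omega)
  have hcoeff : ∀ k ≤ m, ∑ j : Fin (2 * (m + 1)), (if j.val / 2 = k then c j * ε j else 0) = 0 := by
    intro k hk
    have h := congrArg (fun r : ℂ[X] => r.coeff (3 ^ k)) hp
    simp only [p, finsetSum_coeff, coeff_add, coeff_C_mul_X_pow, coeff_zero] at h
    refine (Finset.sum_congr rfl fun j _ => ?_).trans h
    have hne : 3 ^ k ≠ N - 3 ^ (j.val / 2) := by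
      intro heq
      have h1 := hpow j
      have hsum : 3 ^ k + 3 ^ (j.val / 2) + 2 = 3 ^ m + 3 ^ m := by omega
      have hkm : (3 : ℕ) ^ k ≤ 3 ^ m := Nat.pow_le_pow_right (by norm_num) hk
      have hsm : ∀ i < m, 3 * 3 ^ i ≤ 3 ^ m := fun i hi => by
        rw [← pow_succ']; exact Nat.pow_le_pow_right (by norm_num) hi
      rcases hk.lt_or_eq with h2 | rfl
      · have := hsm k h2
        omega
      · rcases (show j.val / 2 ≤ k by omega).lt_or_eq with h3 | h3
        · have := hsm _ h3
          omega
        · rw [h3] at hsum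
          omega
    rw [if_neg hne, add_zero]
    refine if_congr ?_ rfl rfl
    rw [Nat.pow_right_inj (le_refl 3 |>.trans' (by norm_num))]
    exact eq_comm
  funext j₀
  have h := hcoeff (j₀.val / 2) (by omega)
  rcases Nat.mod_two_eq_zero_or_one j₀.val with hj | hj
  · have h' := congrArg Complex.re h
    rw [Complex.re_sum, Finset.sum_eq_single j₀] at h'
    · simpa [ε, hj] using h'
    · intro j _ hne
      have := Fin.val_ne_of_ne hne
      split_ifs with h1
      · have : j.val % 2 = 1 := by omega
        simp [ε, this]
      · rfl
    · simp
  · have h' := congrArg Complex.im h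
    rw [Complex.im_sum, Finset.sum_eq_single j₀] at h'
    · simpa [ε, hj] using h'
    · intro j _ hne
      have := Fin.val_ne_of_ne hne
      split_ifs with h1
      · have : j.val % 2 = 0 := by omega
        simp [ε, this]
      · rfl
    · simp

lemma affineSpan_Phi_image_Apts {m : ℕ} (hm : 2 ≤ m) :
    affineSpan ℝ (Phi m '' ↑(Apts m)) = ⊤ := by
  rw [Phi_image_Apts hm,
    AffineSubspace.affineSpan_eq_top_iff_vectorSpan_eq_top_of_nonempty _ _ _ (range_nonempty _)]
  by_contra hne
  obtain ⟨f, hf0, hf⟩ := Submodule.exists_le_ker_of_lt_top _ (lt_top_iff_ne_top.2 hne)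
  have hzero : ∀ l : ℤ, f (Phi m (angle m l)) = 0 := by
    intro l
    have h := hf (vsub_mem_vectorSpan ℝ (mem_range_self l) (mem_range_self (l + (3 ^ m - 1))))
    simp only [LinearMap.mem_ker, ← neg_Phi_angle hm, vsub_eq_sub, sub_neg_eq_add, map_add] at h
    linarith
  have hsum : ∀ x, f x = ∑ j, f (Pi.single j 1) * x j := fun x => by
    conv_lhs => rw [pi_eq_sum_univ' x, map_sum]
    simp [mul_comm]
  have hc := eq_zero_of_forall_sum_mul_Phi_eq_zero hm (fun j => f (Pi.single j 1))
    fun l => (hsum _).symm.trans (hzero l)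
  refine hf0 (LinearMap.ext fun x => ?_)
  rw [hsum]
  simp [fun j => congrFun hc j]

lemma neg_Phi_image_Apts {m : ℕ} (hm : 2 ≤ m) : -(Phi m '' ↑(Apts m)) = Phi m '' ↑(Apts m) := by
  rw [Phi_image_Apts hm]
  have h : ∀ x ∈ range fun l : ℤ => Phi m (angle m l),
      -x ∈ range fun l : ℤ => Phi m (angle m l) := by
    rintro _ ⟨l, rfl⟩
    exact ⟨_, (neg_Phi_angle hm l).symm⟩
  exact Subset.antisymm (fun x hx => neg_neg x ▸ h _ hx) h

theorem stmt4 (m : ℕ) (hm : 2 ≤ m) :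
    (convexHull ℝ (Phi m '' ↑(Apts m)) = -convexHull ℝ (Phi m '' ↑(Apts m))) ∧
    affineSpan ℝ (convexHull ℝ (Phi m '' ↑(Apts m))) = ⊤ ∧
    (convexHull ℝ (Phi m '' ↑(Apts m))).extremePoints ℝ = Phi m '' ↑(Apts m) ∧
    ((convexHull ℝ (Phi m '' ↑(Apts m))).extremePoints ℝ).ncard = 2 * (3 ^ m - 1) ∧
    (∀ u ∈ (convexHull ℝ (Phi m '' ↑(Apts m))).extremePoints ℝ,
      ∀ w ∈ (convexHull ℝ (Phi m '' ↑(Apts m))).extremePoints ℝ,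
        u ≠ w → w ≠ -u →
          IsProperFace (convexHull ℝ (Phi m '' ↑(Apts m))) (segment ℝ u w)) := by
  rw [extremePoints_convexHull_Phi hm]
  refine ⟨?_, ?_, rfl, ncard_Phi_image_Apts hm, ?_⟩
  · rw [← convexHull_neg, neg_Phi_image_Apts hm]
  · rw [affineSpan_convexHull, affineSpan_Phi_image_Apts hm]
  intro u hu w hw huw hwu
  refine ⟨⟨u, left_mem_segment ℝ u w⟩, ?_, ?_⟩
  · intro heq
    have hneg : -u ∈ Phi m '' ↑(Apts m) := by
      rw [← neg_Phi_image_Apts hm]; simpa using hu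
    rw [← extremePoints_convexHull_Phi hm, ← heq, ← convexHull_pair] at hneg
    rcases extremePoints_convexHull_subset hneg with h | h
    · have hu0 : u = 0 := self_eq_neg.1 h.symm
      rw [Phi_image_Apts hm] at hu
      obtain ⟨a, ha⟩ := hu
      have h1 := cosFunctional_Phi m 0 (by omega) (angle m a) (angle m a)
      dsimp only at ha
      rw [ha, hu0] at h1
      simp at h1
    · exact hwu h.symm
  · rw [Phi_image_Apts hm] at hu hw
    obtain ⟨a, rfl⟩ := hu
    obtain ⟨b, rfl⟩ := hw
    exact isExposed_segment_Phi hm a b hwu
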